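/- An algebra (G,·,⋏) is isomorphic to some ∩-semigroup of invertible (one-to-one) transformations if and only if (G,·) is a semigroup, (G,⋏) is a semilattice, the operation · is distributive over ⋏ on both sides (x(y⋏z) = xy⋏xz and (x⋏y)z = xz⋏yz), and xv ⋏ uv ⋏ uy ⋏ xy = xv ⋏ uv ⋏ uy holds for all x,y,u,v ∈ G¹ such that the products xv, uv, uy, xy all lie in G. -/

import Mathlib

universe u

/-- A transformation (partial map) of `A`, viewed as a binary relation. -/
def IsTransformation {A : Type*} (f : Set (A × A)) : Prop :=
  ∀ ⦃a b c : A⦄, (a, b) ∈ f → (a, c) ∈ f → b = c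

/-- An invertible (one-to-one) transformation. -/
def IsInvertible {A : Type*} (f : Set (A × A)) : Prop :=
  ∀ ⦃a b c : A⦄, (a, c) ∈ f → (b, c) ∈ f → a = b

/-- Composition of binary relations: `comp g f = g ∘ f`. -/
def comp {A : Type*} (g f : Set (A × A)) : Set (A × A) :=
  {p | ∃ b, (p.1, b) ∈ f ∧ (b, p.2) ∈ g}

/-- Multiplication on `G¹ = G ∪ {e}` (`none` being the adjoined identity `e`). -/
def mul1 {G : Type u} (mul : G → G → G) : Option G → Option G → Option G
  | none, b => b
  | some a, none => some a
  | some a, some b => some (mul a b)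

theorem mem_comp {A : Type*} {g f : Set (A × A)} {p q : A} :
    (p, q) ∈ comp g f ↔ ∃ b, (p, b) ∈ f ∧ (b, q) ∈ g := Iff.rfl

section Algebra

variable {G : Type u} {mul meet : G → G → G}

theorem mul1_assoc (assoc : ∀ a b c, mul (mul a b) c = mul a (mul b c)) (x y z : Option G) :
    mul1 mul (mul1 mul x y) z = mul1 mul x (mul1 mul y z) := by
  cases x <;> cases y <;> cases z <;> simp [mul1, assoc]

/-- The relation on `A` represented by an element of `G¹`, with the adjoined identity represented
by the diagonal. -/
def rel1 {A : Type*} (P : G → Set (A × A)) : Option G → Set (A × A)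
  | none => {p | p.1 = p.2}
  | some a => P a

theorem rel1_mul1 {A : Type*} {P : G → Set (A × A)}
    (hP : ∀ a b, P (mul a b) = comp (P b) (P a)) (x y : Option G) :
    rel1 P (mul1 mul x y) = comp (rel1 P y) (rel1 P x) := by
  ext ⟨p, q⟩
  cases x <;> cases y <;> simp [mul1, rel1, comp, hP]

theorem isTransformation_rel1 {A : Type*} {P : G → Set (A × A)}
    (hP : ∀ a, IsTransformation (P a)) (x : Option G) : IsTransformation (rel1 P x) := by
  cases x with
  | none => intro a b c hb hc; exact Eq.trans (Eq.symm hb) hc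
  | some a => exact hP a

theorem isInvertible_rel1 {A : Type*} {P : G → Set (A × A)}
    (hP : ∀ a, IsInvertible (P a)) (x : Option G) : IsInvertible (rel1 P x) := by
  cases x with
  | none => intro a b c hb hc; exact Eq.trans hb (Eq.symm hc)
  | some a => exact hP a

theorem comp_assoc {A : Type*} (h g f : Set (A × A)) :
    comp h (comp g f) = comp (comp h g) f := by
  ext ⟨p, q⟩
  simp only [mem_comp]
  constructor
  · rintro ⟨c, ⟨b, h₁, h₂⟩, h₃⟩; exact ⟨b, h₁, c, h₂, h₃⟩
  · rintro ⟨b, h₁, c, h₂, h₃⟩; exact ⟨c, ⟨b, h₁, h₂⟩, h₃⟩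

theorem comp_inter_left {A : Type*} {f g h : Set (A × A)} (hf : IsTransformation f) :
    comp (g ∩ h) f = comp g f ∩ comp h f := by
  ext ⟨p, q⟩
  simp only [mem_comp, Set.mem_inter_iff]
  constructor
  · rintro ⟨b, h₁, h₂, h₃⟩; exact ⟨⟨b, h₁, h₂⟩, b, h₁, h₃⟩
  · rintro ⟨⟨b, h₁, h₂⟩, c, h₃, h₄⟩
    obtain rfl := hf h₁ h₃
    exact ⟨b, h₁, h₂, h₄⟩

theorem comp_inter_right {A : Type*} {f g h : Set (A × A)} (hf : IsInvertible f) :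
    comp f (g ∩ h) = comp f g ∩ comp f h := by
  ext ⟨p, q⟩
  simp only [mem_comp, Set.mem_inter_iff]
  constructor
  · rintro ⟨b, ⟨h₁, h₂⟩, h₃⟩; exact ⟨⟨b, h₁, h₃⟩, b, h₂, h₃⟩
  · rintro ⟨⟨b, h₁, h₂⟩, c, h₃, h₄⟩
    obtain rfl := hf h₂ h₄
    exact ⟨b, ⟨h₁, h₃⟩, h₂⟩

theorem comp_inter_subset {A : Type*} {x y v w : Set (A × A)} (hv : IsInvertible v)
    (hw : IsTransformation w) : comp v x ∩ comp v w ∩ comp y w ⊆ comp y x := by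
  rintro ⟨p, q⟩ ⟨⟨⟨b, h₁, h₂⟩, c, h₃, h₄⟩, d, h₅, h₆⟩
  obtain rfl := hv h₂ h₄
  obtain rfl := hw h₃ h₅
  exact ⟨b, h₁, h₆⟩

/-- The principal filter of `k` in `G`, extended to `G¹`: the adjoined identity belongs to it
exactly when `k ≤ k * k`. -/
def PrincipalFilter (mul meet : G → G → G) (k : G) : Option G → Prop
  | none => meet k (mul k k) = k
  | some a => meet k a = k

/-- The elements of `G¹` which multiply `x` into the principal filter of `k`. -/
def rightResidual (mul meet : G → G → G) (k : G) (x : Option G) : Set (Option G) :=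
  {v | PrincipalFilter mul meet k (mul1 mul x v)}

/-- The partial map sending the residual of `x` to the residual of `x * g`, on the disjoint union
over all principal filters. -/
def residualMap (mul meet : G → G → G) (g : G) :
    Set (Option (G × Set (Option G)) × Option (G × Set (Option G))) :=
  {p | ∃ k x, (rightResidual mul meet k (mul1 mul x (some g))).Nonempty ∧
    p.1 = some (k, rightResidual mul meet k x) ∧
    p.2 = some (k, rightResidual mul meet k (mul1 mul x (some g)))}

/-- The axioms characterising `∩`-semigroups of invertible transformations up to isomorphism. -/
structure IsInvertibleMeetSemigroup (mul meet : G → G → G) : Prop where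
  assoc : ∀ a b c, mul (mul a b) c = mul a (mul b c)
  comm : ∀ a b, meet a b = meet b a
  meet_assoc : ∀ a b c, meet (meet a b) c = meet a (meet b c)
  idem : ∀ a, meet a a = a
  left_distrib : ∀ x y z, mul x (meet y z) = meet (mul x y) (mul x z)
  right_distrib : ∀ x y z, mul (meet x y) z = meet (mul x z) (mul y z)
  difunctional : ∀ (x y v w : Option G) (a b c d : G),
    mul1 mul x v = some a → mul1 mul w v = some b →
    mul1 mul w y = some c → mul1 mul x y = some d →
    meet (meet (meet a b) c) d = meet (meet a b) c

namespace IsInvertibleMeetSemigroup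

theorem le_meet_iff (h : IsInvertibleMeetSemigroup mul meet) {k a b : G} :
    meet k (meet a b) = k ↔ meet k a = k ∧ meet k b = k := by
  constructor
  · intro hk
    constructor
    · rw [← hk, h.meet_assoc, h.comm _ a, ← h.meet_assoc a a, h.idem]
    · rw [← hk, h.meet_assoc, h.meet_assoc a b b, h.idem]
  · rintro ⟨ha, hb⟩
    rw [← h.meet_assoc, ha, hb]

theorem le_trans (h : IsInvertibleMeetSemigroup mul meet) {k a b : G}
    (ha : meet k a = k) (hb : meet a b = a) : meet k b = k := by
  rw [← ha, h.meet_assoc, hb]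

theorem mul_le_mul (h : IsInvertibleMeetSemigroup mul meet) {a b c d : G}
    (hab : meet a b = a) (hcd : meet c d = c) : meet (mul a c) (mul b d) = mul a c := by
  refine h.le_trans (a := mul b c) ?_ ?_
  · rw [← h.right_distrib, hab]
  · rw [← h.left_distrib, hcd]

theorem le_of_difunctional (h : IsInvertibleMeetSemigroup mul meet) (x y v w : Option G)
    {k a b c d : G} (hxv : mul1 mul x v = some a) (hwv : mul1 mul w v = some b)
    (hwy : mul1 mul w y = some c) (hxy : mul1 mul x y = some d)
    (ha : meet k a = k) (hb : meet k b = k) (hc : meet k c = k) : meet k d = k :=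
  h.le_trans (h.le_meet_iff.2 ⟨h.le_meet_iff.2 ⟨ha, hb⟩, hc⟩)
    (h.difunctional x y v w a b c d hxv hwv hwy hxy)

theorem mem_of_mem (h : IsInvertibleMeetSemigroup mul meet) {k : G} {x y v w : Option G}
    (hxv : PrincipalFilter mul meet k (mul1 mul x v))
    (hwv : PrincipalFilter mul meet k (mul1 mul w v))
    (hwy : PrincipalFilter mul meet k (mul1 mul w y)) :
    PrincipalFilter mul meet k (mul1 mul x y) := by
  have mul_mem {a b : G} (hk : meet k (mul k k) = k) (ha : meet k a = k) (hb : meet k b = k) :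
      meet k (mul a b) = k := h.le_trans hk (h.mul_le_mul ha hb)
  rcases e₁ : mul1 mul x v with _ | a
  · obtain ⟨rfl, rfl⟩ : x = none ∧ v = none := by cases x <;> cases v <;> simp_all [mul1]
    rcases w with _ | u
    · exact hwy
    rcases y with _ | y
    · exact hxv
    exact h.le_of_difunctional none (some y) (some k) (some u) rfl rfl rfl rfl (h.idem k)
      (mul_mem hxv hwv (h.idem k)) hwy
  rcases e₂ : mul1 mul w v with _ | b
  · obtain ⟨rfl, rfl⟩ : w = none ∧ v = none := by cases w <;> cases v <;> simp_all [mul1]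
    rcases x with _ | x
    · exact hwy
    rcases y with _ | y
    · exact hxv
    exact mul_mem hwv hxv hwy
  rcases e₃ : mul1 mul w y with _ | c
  · obtain ⟨rfl, rfl⟩ : w = none ∧ y = none := by cases w <;> cases y <;> simp_all [mul1]
    rcases x with _ | x
    · exact hwy
    rcases v with _ | v
    · exact hxv
    exact h.le_of_difunctional (some x) none (some v) (some k) rfl rfl rfl rfl hxv
      (mul_mem hwy (h.idem k) hwv) (h.idem k)
  rcases e₄ : mul1 mul x y with _ | d
  · obtain ⟨rfl, rfl⟩ : x = none ∧ y = none := by cases x <;> cases y <;> simp_all [mul1]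
    rcases v with _ | v
    · exact hxv
    rcases w with _ | u
    · exact hwy
    have hkv : meet k (mul k v) = k :=
      h.le_of_difunctional (some k) (some v) none (some u) rfl rfl rfl rfl (h.idem k) hwy hwv
    exact h.le_of_difunctional (some k) (some k) (some v) none rfl rfl rfl rfl hkv hxv (h.idem k)
  rw [e₁] at hxv
  rw [e₂] at hwv
  rw [e₃] at hwy
  exact h.le_of_difunctional x y v w e₁ e₂ e₃ e₄ hxv hwv hwy

theorem rightResidual_eq (h : IsInvertibleMeetSemigroup mul meet) {k : G} {x y v : Option G}
    (hx : v ∈ rightResidual mul meet k x) (hy : v ∈ rightResidual mul meet k y) :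
    rightResidual mul meet k x = rightResidual mul meet k y :=
  Set.ext fun _ => ⟨h.mem_of_mem hy hx, h.mem_of_mem hx hy⟩

theorem mem_rightResidual_mul1 (h : IsInvertibleMeetSemigroup mul meet) {k : G} {x y v : Option G} :
    v ∈ rightResidual mul meet k (mul1 mul x y) ↔ mul1 mul y v ∈ rightResidual mul meet k x := by
  simp only [rightResidual, Set.mem_ofPred_eq, mul1_assoc h.assoc]

theorem rightResidual_mul1_congr (h : IsInvertibleMeetSemigroup mul meet) {k : G} {x y : Option G}
    (hxy : rightResidual mul meet k x = rightResidual mul meet k y) (z : Option G) :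
    rightResidual mul meet k (mul1 mul x z) = rightResidual mul meet k (mul1 mul y z) := by
  ext v
  rw [h.mem_rightResidual_mul1, h.mem_rightResidual_mul1, hxy]

theorem mem_rightResidual_mul1_meet (h : IsInvertibleMeetSemigroup mul meet) {k g g' : G}
    {x v : Option G} :
    v ∈ rightResidual mul meet k (mul1 mul x (some (meet g g'))) ↔
      v ∈ rightResidual mul meet k (mul1 mul x (some g)) ∧
        v ∈ rightResidual mul meet k (mul1 mul x (some g')) := by
  cases x <;> cases v <;>
    simp [rightResidual, mul1, PrincipalFilter, h.left_distrib, h.right_distrib, h.le_meet_iff]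

theorem isTransformation_residualMap (h : IsInvertibleMeetSemigroup mul meet) (g : G) :
    IsTransformation (residualMap mul meet g) := by
  rintro _ _ _ ⟨k, x, -, rfl, rfl⟩ ⟨k', x', -, he, rfl⟩
  simp only [Option.some.injEq, Prod.mk.injEq] at he
  obtain ⟨rfl, he⟩ := he
  simp only [h.rightResidual_mul1_congr he]

theorem isInvertible_residualMap (h : IsInvertibleMeetSemigroup mul meet) (g : G) :
    IsInvertible (residualMap mul meet g) := by
  rintro _ _ _ ⟨k, x, ⟨v, hv⟩, rfl, rfl⟩ ⟨k', x', -, rfl, he⟩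
  simp only [Option.some.injEq, Prod.mk.injEq] at he
  obtain ⟨rfl, he⟩ := he
  have hv' := he ▸ hv
  rw [h.mem_rightResidual_mul1] at hv hv'
  rw [h.rightResidual_eq hv hv']

theorem residualMap_mul (h : IsInvertibleMeetSemigroup mul meet) (a b : G) :
    residualMap mul meet (mul a b) = comp (residualMap mul meet b) (residualMap mul meet a) := by
  have key (x : Option G) : mul1 mul x (some (mul a b)) =
      mul1 mul (mul1 mul x (some a)) (some b) := (mul1_assoc h.assoc x (some a) (some b)).symm
  ext ⟨p, q⟩
  constructor
  · rintro ⟨k, x, hne, hp, hq⟩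
    rw [key] at hne hq
    obtain ⟨v, hv⟩ := hne
    exact ⟨some (k, rightResidual mul meet k (mul1 mul x (some a))),
      ⟨k, x, ⟨_, h.mem_rightResidual_mul1.1 hv⟩, hp, rfl⟩, k, _, ⟨v, hv⟩, rfl, hq⟩
  · rintro ⟨_, ⟨k, x, -, hp, rfl⟩, k', x', hne, he, hq⟩
    simp only [Option.some.injEq, Prod.mk.injEq] at he
    obtain ⟨rfl, he⟩ := he
    rw [← h.rightResidual_mul1_congr he] at hne hq
    exact ⟨k, x, by rwa [key], hp, by rwa [key]⟩

theorem residualMap_meet (h : IsInvertibleMeetSemigroup mul meet) (a b : G) :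
    residualMap mul meet (meet a b) = residualMap mul meet a ∩ residualMap mul meet b := by
  ext ⟨p, q⟩
  constructor
  · rintro ⟨k, x, ⟨v, hv⟩, hp, hq⟩
    obtain ⟨ha, hb⟩ := h.mem_rightResidual_mul1_meet.1 hv
    exact ⟨⟨k, x, ⟨v, ha⟩, hp, by rwa [h.rightResidual_eq ha hv]⟩,
      k, x, ⟨v, hb⟩, hp, by rwa [h.rightResidual_eq hb hv]⟩
  · rintro ⟨⟨k, x, ⟨v, hv⟩, rfl, rfl⟩, k', x', -, he, he'⟩
    simp only [Option.some.injEq, Prod.mk.injEq] at he he'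
    obtain ⟨rfl, he⟩ := he
    replace he' := he'.2
    rw [← h.rightResidual_mul1_congr he] at he'
    have hm := h.mem_rightResidual_mul1_meet.2 ⟨hv, he' ▸ hv⟩
    exact ⟨k, x, ⟨v, hm⟩, rfl, by simp only [h.rightResidual_eq hm hv]⟩

theorem le_of_residualMap_subset (h : IsInvertibleMeetSemigroup mul meet) {a b : G}
    (hab : residualMap mul meet a ⊆ residualMap mul meet b) : meet a b = a := by
  have ha : none ∈ rightResidual mul meet a (mul1 mul none (some a)) := h.idem a
  have hmem : (some (a, rightResidual mul meet a none),
      some (a, rightResidual mul meet a (mul1 mul none (some a)))) ∈ residualMap mul meet a :=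
    ⟨a, none, ⟨none, ha⟩, rfl, rfl⟩
  obtain ⟨k, x, -, he, he'⟩ := hab hmem
  simp only [Option.some.injEq, Prod.mk.injEq] at he he'
  obtain ⟨rfl, he⟩ := he
  rw [he'.2, h.mem_rightResidual_mul1, ← he] at ha
  exact ha

theorem residualMap_injective (h : IsInvertibleMeetSemigroup mul meet) :
    Function.Injective (residualMap mul meet) := fun a b hab => by
  rw [← h.le_of_residualMap_subset hab.subset, h.comm, h.le_of_residualMap_subset hab.superset]

end IsInvertibleMeetSemigroup

end Algebra

/-- Garvatskii's theorem: an algebra (G,·,⋏) is isomorphic to some ∩-semigroup of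
invertible (one-to-one) transformations iff (G,·) is a semigroup, (G,⋏) is a
semilattice, · distributes over ⋏ on both sides, and
xv ⋏ uv ⋏ uy ⋏ xy = xv ⋏ uv ⋏ uy for all x,y,u,v ∈ G¹ with xv,uv,uy,xy ∈ G. -/
theorem statement_3 {G : Type u} (mul meet : G → G → G) :
    (∃ (A : Type u) (_ : Nonempty A) (Φ : Set (Set (A × A))),
      (∀ f ∈ Φ, IsTransformation f) ∧
      (∀ f ∈ Φ, IsInvertible f) ∧
      (∀ f ∈ Φ, ∀ g ∈ Φ, comp g f ∈ Φ) ∧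
      (∀ f ∈ Φ, ∀ g ∈ Φ, f ∩ g ∈ Φ) ∧
      ∃ P : G → Set (A × A),
        (∀ g, P g ∈ Φ) ∧ Function.Injective P ∧ (∀ f ∈ Φ, ∃ g, P g = f) ∧
        (∀ a b, P (mul a b) = comp (P b) (P a)) ∧
        (∀ a b, P (meet a b) = P a ∩ P b)) ↔
    ((∀ a b c, mul (mul a b) c = mul a (mul b c)) ∧
     (∀ a b, meet a b = meet b a) ∧
     (∀ a b c, meet (meet a b) c = meet a (meet b c)) ∧
     (∀ a, meet a a = a) ∧
     (∀ x y z, mul x (meet y z) = meet (mul x y) (mul x z)) ∧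
     (∀ x y z, mul (meet x y) z = meet (mul x z) (mul y z)) ∧
     (∀ (x y v w : Option G) (a b c d : G),
       mul1 mul x v = some a → mul1 mul w v = some b →
       mul1 mul w y = some c → mul1 mul x y = some d →
       meet (meet (meet a b) c) d = meet (meet a b) c)) := by
  constructor
  · rintro ⟨A, -, Φ, hT, hI, -, -, P, hΦ, inj, -, hmul, hmeet⟩
    have hT' a : IsTransformation (P a) := hT _ (hΦ a)
    have hI' a : IsInvertible (P a) := hI _ (hΦ a)
    refine ⟨fun a b c => inj ?_, fun a b => inj ?_, fun a b c => inj ?_, fun a => inj ?_,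
      fun x y z => inj ?_, fun x y z => inj ?_, fun x y v w a b c d ha hb hc hd => inj ?_⟩
    · simp only [hmul, comp_assoc]
    · rw [hmeet, hmeet, Set.inter_comm]
    · simp only [hmeet, Set.inter_assoc]
    · rw [hmeet, Set.inter_self]
    · simp only [hmul, hmeet, comp_inter_left (hT' x)]
    · simp only [hmul, hmeet, comp_inter_right (hI' z)]
    · have key {x y : Option G} {a : G} (hxy : mul1 mul x y = some a) :
          P a = comp (rel1 P y) (rel1 P x) := by
        rw [← rel1_mul1 hmul, hxy, rel1]
      simp only [hmeet]
      rw [key ha, key hb, key hc, key hd]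
      exact Set.inter_eq_left.2
        (comp_inter_subset (isInvertible_rel1 hI' v) (isTransformation_rel1 hT' w))
  · rintro ⟨h₁, h₂, h₃, h₄, h₅, h₆, h₇⟩
    have h : IsInvertibleMeetSemigroup mul meet := ⟨h₁, h₂, h₃, h₄, h₅, h₆, h₇⟩
    refine ⟨Option (G × Set (Option G)), ⟨none⟩, Set.range (residualMap mul meet), ?_, ?_, ?_, ?_,
      residualMap mul meet, Set.mem_range_self, h.residualMap_injective, fun _ hf => hf,
      h.residualMap_mul, h.residualMap_meet⟩
    · rintro _ ⟨g, rfl⟩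
      exact h.isTransformation_residualMap g
    · rintro _ ⟨g, rfl⟩
      exact h.isInvertible_residualMap g
    · rintro _ ⟨a, rfl⟩ _ ⟨b, rfl⟩
      exact ⟨mul a b, h.residualMap_mul a b⟩
    · rintro _ ⟨a, rfl⟩ _ ⟨b, rfl⟩
      exact ⟨meet a b, h.residualMap_meet a b⟩
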